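/- arXiv:1603.04482 — 3 statements merged into one kernel-verified Lean document; each statement's English description precedes it below -/
import Mathlib

section
/- For all bias vectors b, b' : U → ℝ and every object j : O, |R(b)(j) − R(b')(j)| ≤ α · max_{i : U} |b(i) − b'(i)|. -/
open Finset

noncomputable def clamp (x : ℝ) : ℝ := max 0 (min 1 x)

/-- The set of users rating object `j`. -/
def dminus {U O : Type} [Fintype U] [DecidableEq O] (dplus : U → Finset O) (j : O) :
    Finset U :=
  Finset.univ.filter (fun i => j ∈ dplus i)

/-- The true-rating map `R(b)`. -/
noncomputable def Rmap {U O : Type} [Fintype U] [DecidableEq O] (dplus : U → Finset O)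
    (w : U → O → ℝ) (α : ℝ) (b : U → ℝ) (j : O) : ℝ :=
  (∑ i ∈ dminus dplus j, clamp (w i j - α * b i)) / (dminus dplus j).card

/-- The bias-update map `T(b)`. -/
noncomputable def Tmap {U O : Type} [Fintype U] [DecidableEq O] (dplus : U → Finset O)
    (w : U → O → ℝ) (α : ℝ) (b : U → ℝ) (i : U) : ℝ :=
  (∑ j ∈ dplus i, (w i j - Rmap dplus w α b j)) / (dplus i).card

theorem abs_clamp_sub_clamp_le (x y : ℝ) : |clamp x - clamp y| ≤ |x - y| := by
  unfold clamp
  calc |max 0 (min 1 x) - max 0 (min 1 y)| ≤ |min 1 x - min 1 y| := by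
        simpa using abs_max_sub_max_le_max 0 (min 1 x) 0 (min 1 y)
    _ ≤ |x - y| := by simpa using abs_min_sub_min_le_max 1 x 1 y

theorem rating_lipschitz
    {U O : Type} [Fintype U] [Nonempty U] [Fintype O] [Nonempty O] [DecidableEq O]
    (dplus : U → Finset O) (hd : ∀ i : U, (dplus i).Nonempty)
    (hdm : ∀ j : O, (dminus dplus j).Nonempty)
    (w : U → O → ℝ) (hw : ∀ i j, w i j ∈ Set.Icc (0 : ℝ) 1)
    (α : ℝ) (hα0 : 0 < α) (hα1 : α < 1)
    (b b' : U → ℝ) (j : O) :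
    |Rmap dplus w α b j - Rmap dplus w α b' j| ≤
      α * (Finset.univ.sup' Finset.univ_nonempty (fun i : U => |b i - b' i|)) := by
  have hcard : (0 : ℝ) < (dminus dplus j).card := by exact_mod_cast (hdm j).card_pos
  unfold Rmap
  rw [← sub_div, ← Finset.sum_sub_distrib, abs_div, abs_of_pos hcard, div_le_iff₀ hcard,
    mul_comm _ ((dminus dplus j).card : ℝ), ← nsmul_eq_mul]
  refine (Finset.abs_sum_le_sum_abs _ _).trans (Finset.sum_le_card_nsmul _ _ _ fun i _ => ?_)
  calc |clamp (w i j - α * b i) - clamp (w i j - α * b' i)|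
      ≤ |(w i j - α * b i) - (w i j - α * b' i)| := abs_clamp_sub_clamp_le _ _
    _ = α * |b i - b' i| := by
        rw [sub_sub_sub_cancel_left, ← mul_sub, abs_mul, abs_of_pos hα0, abs_sub_comm]
    _ ≤ α * Finset.univ.sup' Finset.univ_nonempty (fun i : U => |b i - b' i|) :=
        mul_le_mul_of_nonneg_left
          (Finset.le_sup' (fun i : U => |b i - b' i|) (Finset.mem_univ i)) hα0.le
end

section
/- The bias-update map T is a contraction with factor α in the supremum norm: for all bias vectors b, b' : U → ℝ, max_{i : U} |T(b)(i) − T(b')(i)| ≤ α · max_{i : U} |b(i) − b'(i)|. -/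
open Finset

theorem abs_average_sub_average_le {ι : Type*} {s : Finset ι} (hs : s.Nonempty) {f g : ι → ℝ}
    {C : ℝ} (h : ∀ i ∈ s, |f i - g i| ≤ C) :
    |(∑ i ∈ s, f i) / s.card - (∑ i ∈ s, g i) / s.card| ≤ C := by
  have hc : (0 : ℝ) < s.card := by exact_mod_cast hs.card_pos
  rw [← sub_div, ← Finset.sum_sub_distrib, abs_div, abs_of_pos hc, div_le_iff₀ hc]
  calc |∑ i ∈ s, (f i - g i)| ≤ ∑ i ∈ s, |f i - g i| := Finset.abs_sum_le_sum_abs _ _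
    _ ≤ s.card • C := Finset.sum_le_card_nsmul _ _ _ h
    _ = C * s.card := by rw [nsmul_eq_mul, mul_comm]

theorem bias_update_contraction
    {U O : Type} [Fintype U] [Nonempty U] [Fintype O] [Nonempty O] [DecidableEq O]
    (dplus : U → Finset O) (hd : ∀ i : U, (dplus i).Nonempty)
    (hdm : ∀ j : O, (dminus dplus j).Nonempty)
    (w : U → O → ℝ) (hw : ∀ i j, w i j ∈ Set.Icc (0 : ℝ) 1)
    (α : ℝ) (hα0 : 0 < α) (hα1 : α < 1)
    (b b' : U → ℝ) :
    Finset.univ.sup' Finset.univ_nonempty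
        (fun i : U => |Tmap dplus w α b i - Tmap dplus w α b' i|) ≤
      α * (Finset.univ.sup' Finset.univ_nonempty (fun i : U => |b i - b' i|)) := by
  refine Finset.sup'_le _ _ fun i _ => abs_average_sub_average_le (hd i) fun j _ => ?_
  rw [sub_sub_sub_cancel_left, abs_sub_comm]
  refine abs_average_sub_average_le (hdm j) fun k _ => ?_
  calc |clamp (w k j - α * b k) - clamp (w k j - α * b' k)|
      ≤ |(w k j - α * b k) - (w k j - α * b' k)| := abs_clamp_sub_clamp_le _ _
    _ = α * |b k - b' k| := by
      rw [sub_sub_sub_cancel_left, ← mul_sub, abs_mul, abs_of_pos hα0, abs_sub_comm]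
    _ ≤ _ := mul_le_mul_of_nonneg_left
      (Finset.le_sup' (fun i : U => |b i - b' i|) (Finset.mem_univ k)) hα0.le
end

section
/- For any initial bias b⁰ : U → ℝ, the sequence of bias iterates converges: there exists a bias vector b* : U → ℝ such that for every user i : U, the real sequence t ↦ b^{t}(i) tends to b*(i) as t → ∞. -/
open Finset

theorem abs_sum_div_card_le {ι : Type*} {s : Finset ι} (hs : s.Nonempty) {f : ι → ℝ} {C : ℝ}
    (h : ∀ i ∈ s, |f i| ≤ C) : |(∑ i ∈ s, f i) / (s.card : ℝ)| ≤ C := by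
  have hc : (0 : ℝ) < s.card := by exact_mod_cast hs.card_pos
  rw [abs_div, abs_of_pos hc, div_le_iff₀ hc]
  calc |∑ i ∈ s, f i| ≤ ∑ i ∈ s, |f i| := abs_sum_le_sum_abs f s
    _ ≤ s.card • C := sum_le_card_nsmul s _ C h
    _ = C * s.card := by rw [nsmul_eq_mul, mul_comm]

theorem abs_Rmap_sub_Rmap_le {U O : Type} [Fintype U] [DecidableEq O]
    {dplus : U → Finset O} {j : O} (hj : (dminus dplus j).Nonempty)
    (w : U → O → ℝ) {α : ℝ} (hα : 0 ≤ α) (b c : U → ℝ) :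
    |Rmap dplus w α b j - Rmap dplus w α c j| ≤ α * dist b c := by
  rw [Rmap, Rmap, ← sub_div, ← sum_sub_distrib]
  refine abs_sum_div_card_le hj fun i _ => (abs_clamp_sub_clamp_le _ _).trans ?_
  rw [sub_sub_sub_cancel_left, ← mul_sub, abs_mul, abs_of_nonneg hα, abs_sub_comm, ← Real.dist_eq]
  exact mul_le_mul_of_nonneg_left (dist_le_pi_dist b c i) hα

theorem dist_Tmap_le {U O : Type} [Fintype U] [DecidableEq O]
    {dplus : U → Finset O} (hd : ∀ i, (dplus i).Nonempty)
    (hdm : ∀ j, (dminus dplus j).Nonempty)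
    (w : U → O → ℝ) {α : ℝ} (hα : 0 ≤ α) (b c : U → ℝ) :
    dist (Tmap dplus w α b) (Tmap dplus w α c) ≤ α * dist b c := by
  refine (dist_pi_le_iff (mul_nonneg hα dist_nonneg)).2 fun i => ?_
  rw [Real.dist_eq, Tmap, Tmap, ← sub_div, ← sum_sub_distrib]
  refine abs_sum_div_card_le (hd i) fun j _ => ?_
  rw [sub_sub_sub_cancel_left, abs_sub_comm]
  exact abs_Rmap_sub_Rmap_le (hdm j) w hα b c

theorem bias_iterates_converge
    {U O : Type} [Fintype U] [Nonempty U] [Fintype O] [Nonempty O] [DecidableEq O]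
    (dplus : U → Finset O) (hd : ∀ i : U, (dplus i).Nonempty)
    (hdm : ∀ j : O, (dminus dplus j).Nonempty)
    (w : U → O → ℝ) (hw : ∀ i j, w i j ∈ Set.Icc (0 : ℝ) 1)
    (α : ℝ) (hα0 : 0 < α) (hα1 : α < 1)
    (b : ℕ → U → ℝ) (hb : ∀ t, b (t + 1) = Tmap dplus w α (b t)) :
    ∃ bstar : U → ℝ, ∀ i : U,
      Filter.Tendsto (fun t => b t i) Filter.atTop (nhds (bstar i)) := by
  have hT : ContractingWith ⟨α, hα0.le⟩ (Tmap dplus w α) :=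
    ⟨hα1, LipschitzWith.of_dist_le_mul (dist_Tmap_le hd hdm w hα0.le)⟩
  have hiter : ∀ t, b t = (Tmap dplus w α)^[t] (b 0) := by
    intro t
    induction t with
    | zero => rfl
    | succ t ih => rw [hb, ih, Function.iterate_succ_apply']
  refine ⟨hT.fixedPoint, fun i => ?_⟩
  have h := tendsto_pi_nhds.1 (hT.tendsto_iterate_fixedPoint (b 0)) i
  simpa only [← hiter] using h
end
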